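/- Let ℓ ≥ 1 be an integer. For every continuous function f : ℝ² → ℝ, ∫_{[-1,1]²} f(T_ℓ(x₁), T_ℓ(x₂)) W^{(ℓ)}_{-1/2}(x₁,x₂) dx₁dx₂ = ∫_{[-1,1]²} f(x₁,x₂) W_{-1/2}(x₁,x₂) dx₁dx₂. -/

import Mathlib

open MeasureTheory Set Polynomial

noncomputable section

/-- The weight `W_{-1/2}` on the square `[-1,1]²`, with `θᵢ = arccos xᵢ`. -/
def Wm (w : ℝ → ℝ) (x : ℝ × ℝ) : ℝ :=
  w (Real.cos (Real.arccos x.1 - Real.arccos x.2)) *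
  w (Real.cos (Real.arccos x.1 + Real.arccos x.2)) *
  |x.1 ^ 2 - x.2 ^ 2| / (Real.sqrt (1 - x.1 ^ 2) * Real.sqrt (1 - x.2 ^ 2))

/-- The weight `W^{(ℓ)}_{-1/2}` on the square `[-1,1]²`, with `θᵢ = arccos xᵢ`. -/
def WmEll (w : ℝ → ℝ) (ℓ : ℕ) (x : ℝ × ℝ) : ℝ :=
  w (Real.cos (ℓ * (Real.arccos x.1 - Real.arccos x.2))) *
  w (Real.cos (ℓ * (Real.arccos x.1 + Real.arccos x.2))) *
  |((Chebyshev.T ℝ ℓ).eval x.1) ^ 2 - ((Chebyshev.T ℝ ℓ).eval x.2) ^ 2| /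
    (Real.sqrt (1 - x.1 ^ 2) * Real.sqrt (1 - x.2 ^ 2))

open Polynomial.Chebyshev in
/-- The arcsine measure on `[-1, 1]` as a density with respect to Lebesgue measure. -/
theorem measureT_eq_withDensity :
    measureT = (volume.restrict (Icc (-1 : ℝ) 1)).withDensity
      fun x ↦ ENNReal.ofReal (√(1 - x ^ 2)⁻¹) := by
  rw [measureT, restrict_withDensity measurableSet_Ioc, Measure.restrict_congr_set Ioc_ae_eq_Icc]
  congr 1
  ext x
  rw [ENNReal.ofReal, Real.toNNReal_of_nonneg (by positivity)]

open Polynomial.Chebyshev in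
instance isFiniteMeasure_measureT : IsFiniteMeasure measureT := by
  have h := integrable_measureT (f := fun _ ↦ 1) continuousOn_const
  simpa [integrable_const_iff] using h

open Polynomial.Chebyshev in
theorem integral_prod_measureT (F : ℝ × ℝ → ℝ) :
    ∫ x, F x ∂(measureT.prod measureT) =
      ∫ x in Icc (-1 : ℝ) 1 ×ˢ Icc (-1 : ℝ) 1,
        F x / (√(1 - x.1 ^ 2) * √(1 - x.2 ^ 2)) := by
  rw [measureT_eq_withDensity, prod_withDensity (by fun_prop) (by fun_prop),
    Measure.prod_restrict, ← Measure.volume_eq_prod,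
    integral_withDensity_eq_integral_toReal_smul (by fun_prop)
      (Filter.Eventually.of_forall fun x ↦ by simp [ENNReal.mul_lt_top])]
  congr 1
  ext x
  rw [ENNReal.toReal_mul, ENNReal.toReal_ofReal (Real.sqrt_nonneg _),
    ENNReal.toReal_ofReal (Real.sqrt_nonneg _), smul_eq_mul, Real.sqrt_inv, Real.sqrt_inv,
    div_eq_mul_inv, mul_inv, mul_comm]

/-- The mean of an even periodic function over half a period is unchanged by an integer dilation
of the variable. -/
theorem integral_comp_natCast_mul_of_even_of_periodic {h : ℝ → ℝ} (heven : Function.Even h)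
    (hper : Function.Periodic h (2 * Real.pi)) (hint : ∀ a b, IntervalIntegrable h volume a b)
    {n : ℕ} (hn : n ≠ 0) :
    ∫ t in 0..Real.pi, h (n * t) = ∫ t in 0..Real.pi, h t := by
  have hn' : (n : ℝ) ≠ 0 := Nat.cast_ne_zero.mpr hn
  have hdouble (a : ℝ) : ∫ t in -a..a, h t = 2 * ∫ t in 0..a, h t := by
    rw [← intervalIntegral.integral_add_adjacent_intervals (hint (-a) 0) (hint 0 a)]
    have := intervalIntegral.integral_comp_neg (a := 0) (b := a) h
    simp only [heven _, neg_zero] at this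
    rw [← this, two_mul]
  have key := hper.intervalIntegral_add_zsmul_eq n (-(n * Real.pi)) (fun _ _ ↦ hint _ _)
  rw [hper.intervalIntegral_add_eq _ (-Real.pi)] at key
  have e1 : -(n * Real.pi) + (n : ℤ) • (2 * Real.pi) = n * Real.pi := by
    simp; ring
  have e2 : -Real.pi + 2 * Real.pi = Real.pi := by ring
  rw [e1, e2, hdouble, hdouble] at key
  rw [intervalIntegral.integral_comp_mul_left _ hn', mul_zero]
  simp only [zsmul_eq_mul, Int.cast_natCast, smul_eq_mul] at key ⊢
  rw [inv_mul_eq_iff_eq_mul₀ hn']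
  linarith

open Polynomial.Chebyshev in
theorem measurePreserving_eval_T {n : ℕ} (hn : n ≠ 0) :
    MeasurePreserving (fun x ↦ (T ℝ n).eval x) measureT measureT := by
  have hm : Measurable fun x ↦ (T ℝ n).eval x := (T ℝ n).continuous.measurable
  refine ⟨hm, ?_⟩
  ext s hs
  have hreal (u : Set ℝ) (hu : MeasurableSet u) :
      measureT.real u = ∫ t in 0..Real.pi, u.indicator 1 (Real.cos t) := by
    rw [← integral_indicator_one hu, integral_measureT_eq_integral_cos]
  rw [Measure.map_apply hm hs, ← measureReal_eq_measureReal_iff, hreal _ (hm hs), hreal _ hs,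
    ← integral_comp_natCast_mul_of_even_of_periodic (h := fun t ↦ s.indicator 1 (Real.cos t))
      (n := n) _ _ _ hn]
  · refine intervalIntegral.integral_congr fun t _ ↦ ?_
    change s.indicator 1 ((T ℝ n).eval (Real.cos t)) = s.indicator 1 (Real.cos (n * t))
    rw [T_real_cos, Int.cast_natCast]
  · intro t
    simp
  · intro t
    simp
  · intro a b
    rw [intervalIntegrable_iff]
    refine Measure.integrableOn_of_bounded (M := 1) (by simp) ?_ ?_
    · exact ((measurable_one.indicator hs).comp Real.measurable_cos).aestronglyMeasurable
    · refine Filter.Eventually.of_forall fun t ↦ ?_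
      simp only [indicator]
      split_ifs <;> simp

theorem quasiMeasurePreserving_cos : Measure.QuasiMeasurePreserving Real.cos volume volume := by
  refine ⟨Real.measurable_cos, Measure.AbsolutelyContinuous.mk fun s hs h0 ↦ ?_⟩
  rw [Measure.map_apply Real.measurable_cos hs]
  have hdiff : DifferentiableOn ℝ Real.arccos (s ∩ Ioo (-1) 1) := fun x hx ↦
    (Real.differentiableAt_arccos.mpr ⟨hx.2.1.ne', hx.2.2.ne⟩).differentiableWithinAt
  have hnull : volume (Real.arccos '' (s ∩ Ioo (-1) 1)) = 0 :=
    addHaar_image_eq_zero_of_differentiableOn_of_addHaar_eq_zero volume hdiff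
      (measure_mono_null inter_subset_left h0)
  have hA : volume (Real.arccos '' (s ∩ Ioo (-1) 1) ∪ {0, Real.pi}) = 0 :=
    measure_union_null hnull ((Set.toFinite _).measure_zero _)
  set A := Real.arccos '' (s ∩ Ioo (-1) 1) ∪ {0, Real.pi}
  have hsub : Real.cos ⁻¹' s ⊆ ⋃ k : ℤ, (fun t ↦ t - 2 * k * Real.pi) ⁻¹' A ∪
      (fun t ↦ 2 * k * Real.pi - t) ⁻¹' A := by
    intro t ht
    have hmem : Real.arccos (Real.cos t) ∈ A := by
      by_cases h1 : Real.cos t = 1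
      · right; simp [h1]
      by_cases h2 : Real.cos t = -1
      · right; simp [h2]
      · exact Or.inl ⟨_, ⟨ht, lt_of_le_of_ne (Real.neg_one_le_cos t) (Ne.symm h2),
          lt_of_le_of_ne (Real.cos_le_one t) h1⟩, rfl⟩
    obtain ⟨k, hk⟩ := Real.cos_eq_cos_iff.mp
      (Real.cos_arccos (Real.neg_one_le_cos t) (Real.cos_le_one t))
    refine mem_iUnion.mpr ⟨k, ?_⟩
    rcases hk with hk | hk
    · left
      rw [mem_preimage]
      convert hmem using 1
      linarith
    · right
      rw [mem_preimage]
      convert hmem using 1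
      linarith
  refine measure_mono_null hsub (measure_iUnion_null fun k ↦ measure_union_null ?_ ?_)
  · exact (measurePreserving_sub_right volume _).quasiMeasurePreserving.preimage_null hA
  · exact (quasiMeasurePreserving_sub_left_of_right_invariant volume _).preimage_null hA

open Polynomial.Chebyshev in
theorem quasiMeasurePreserving_arccos_measureT :
    Measure.QuasiMeasurePreserving Real.arccos measureT volume := by
  refine ⟨Real.continuous_arccos.measurable, Measure.AbsolutelyContinuous.mk fun s hs h0 ↦ ?_⟩
  rw [Measure.map_apply Real.continuous_arccos.measurable hs, measureT_eq_withDensity]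
  refine withDensity_absolutelyContinuous _ _ ?_
  rw [Measure.restrict_apply (Real.continuous_arccos.measurable hs)]
  refine measure_mono_null ?_ (addHaar_image_eq_zero_of_differentiableOn_of_addHaar_eq_zero volume
    (Real.differentiable_cos.differentiableOn (s := s)) h0)
  rintro x ⟨hx, h1, h2⟩
  exact ⟨Real.arccos x, hx, Real.cos_arccos h1 h2⟩

/-- The numerator of `Wm`, i.e. the density of the weight with respect to the product of
arcsine measures. -/
def numeratorWm (w : ℝ → ℝ) (x : ℝ × ℝ) : ℝ :=
  w (Real.cos (Real.arccos x.1 - Real.arccos x.2)) *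
  w (Real.cos (Real.arccos x.1 + Real.arccos x.2)) * |x.1 ^ 2 - x.2 ^ 2|

open Polynomial.Chebyshev in
theorem aestronglyMeasurable_numeratorWm {w : ℝ → ℝ}
    (hw : AEStronglyMeasurable w (volume.restrict (Icc (-1 : ℝ) 1))) :
    AEStronglyMeasurable (numeratorWm w) (measureT.prod measureT) := by
  have hw' : AEStronglyMeasurable ((Icc (-1 : ℝ) 1).indicator w) volume :=
    (aestronglyMeasurable_indicator_iff measurableSet_Icc).mpr hw
  have hcos (t : ℝ) : w (Real.cos t) = (Icc (-1 : ℝ) 1).indicator w (Real.cos t) :=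
    (indicator_of_mem (Real.cos_mem_Icc t) w).symm
  have harccos : Measure.QuasiMeasurePreserving (Prod.map Real.arccos Real.arccos)
      (measureT.prod measureT) (volume.prod volume) :=
    QuasiMeasurePreserving.prodMap quasiMeasurePreserving_arccos_measureT
      quasiMeasurePreserving_arccos_measureT
  have hsub := hw'.comp_quasiMeasurePreserving (quasiMeasurePreserving_cos.comp
    ((quasiMeasurePreserving_sub_of_right_invariant volume volume).comp harccos))
  have hadd := hw'.comp_quasiMeasurePreserving (quasiMeasurePreserving_cos.comp
    ((quasiMeasurePreserving_add volume volume).comp harccos))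
  unfold numeratorWm
  simp only [hcos]
  refine (hsub.mul hadd).mul (Continuous.aestronglyMeasurable ?_)
  fun_prop

open Polynomial.Chebyshev in
theorem numeratorWm_eval_T (w : ℝ → ℝ) (n : ℕ) {x : ℝ × ℝ}
    (hx : x ∈ Icc (-1 : ℝ) 1 ×ˢ Icc (-1 : ℝ) 1) :
    numeratorWm w ((T ℝ n).eval x.1, (T ℝ n).eval x.2) =
      w (Real.cos (n * (Real.arccos x.1 - Real.arccos x.2))) *
      w (Real.cos (n * (Real.arccos x.1 + Real.arccos x.2))) *
      |((T ℝ n).eval x.1) ^ 2 - ((T ℝ n).eval x.2) ^ 2| := by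
  have hT {y : ℝ} (hy : y ∈ Icc (-1 : ℝ) 1) :
      (T ℝ n).eval y = Real.cos (n * Real.arccos y) := by
    have := T_real_cos (Real.arccos y) n
    rwa [Real.cos_arccos hy.1 hy.2, Int.cast_natCast] at this
  have harccos (t : ℝ) : ∃ k : ℤ, t = 2 * k * Real.pi + Real.arccos (Real.cos t) ∨
      t = 2 * k * Real.pi - Real.arccos (Real.cos t) :=
    Real.cos_eq_cos_iff.mp (Real.cos_arccos (Real.neg_one_le_cos t) (Real.cos_le_one t))
  have hshift (k : ℤ) (t : ℝ) : Real.cos (t + k * (2 * Real.pi)) = Real.cos t :=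
    Real.cos_add_int_mul_two_pi t k
  have hprod (a b : ℝ) : w (Real.cos (Real.arccos (Real.cos a) - Real.arccos (Real.cos b))) *
      w (Real.cos (Real.arccos (Real.cos a) + Real.arccos (Real.cos b))) =
      w (Real.cos (a - b)) * w (Real.cos (a + b)) := by
    obtain ⟨k, hk⟩ := harccos a
    obtain ⟨m, hm⟩ := harccos b
    generalize Real.arccos (Real.cos a) = α at hk ⊢
    generalize Real.arccos (Real.cos b) = β at hm ⊢
    rcases hk with rfl | rfl <;> rcases hm with rfl | rfl
    · rw [← hshift (k - m) (α - β), ← hshift (k + m) (α + β)]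
      push_cast; ring_nf
    · rw [mul_comm, ← hshift (k - m) (α + β), ← hshift (k + m) (α - β)]
      push_cast; ring_nf
    · rw [mul_comm, ← Real.cos_neg (α + β), ← Real.cos_neg (α - β),
        ← hshift (k - m) (-(α + β)), ← hshift (k + m) (-(α - β))]
      push_cast; ring_nf
    · rw [← Real.cos_neg (α - β), ← Real.cos_neg (α + β),
        ← hshift (k - m) (-(α - β)), ← hshift (k + m) (-(α + β))]
      push_cast; ring_nf
  rw [numeratorWm, hT hx.1, hT hx.2, hprod, mul_sub, mul_add]

theorem stmt18 (w : ℝ → ℝ)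
    (hw_nonneg : ∀ t ∈ Icc (-1:ℝ) 1, 0 ≤ w t)
    (hw_int : IntegrableOn w (Icc (-1:ℝ) 1))
    (hw_ne : ¬ (w =ᵐ[volume.restrict (Icc (-1:ℝ) 1)] 0))
    (ℓ : ℕ) (hℓ : 1 ≤ ℓ)
    (f : ℝ × ℝ → ℝ) (hf : Continuous f) :
    (∫ x in (Icc (-1:ℝ) 1) ×ˢ (Icc (-1:ℝ) 1),
      f ((Chebyshev.T ℝ ℓ).eval x.1, (Chebyshev.T ℝ ℓ).eval x.2) * WmEll w ℓ x) =
    ∫ x in (Icc (-1:ℝ) 1) ×ˢ (Icc (-1:ℝ) 1), f x * Wm w x := by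
  have hT := measurePreserving_eval_T (Nat.one_le_iff_ne_zero.mp hℓ)
  have hTT := hT.prod hT
  have hmeas : AEStronglyMeasurable (fun x ↦ f x * numeratorWm w x)
      (Chebyshev.measureT.prod Chebyshev.measureT) :=
    hf.aestronglyMeasurable.mul
      (aestronglyMeasurable_numeratorWm hw_int.aestronglyMeasurable)
  calc
    _ = ∫ x, f ((Chebyshev.T ℝ ℓ).eval x.1, (Chebyshev.T ℝ ℓ).eval x.2) *
          numeratorWm w ((Chebyshev.T ℝ ℓ).eval x.1, (Chebyshev.T ℝ ℓ).eval x.2)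
          ∂(Chebyshev.measureT.prod Chebyshev.measureT) := by
      rw [integral_prod_measureT]
      refine setIntegral_congr_fun (measurableSet_Icc.prod measurableSet_Icc) fun x hx ↦ ?_
      simp only [numeratorWm_eval_T w ℓ hx, WmEll, mul_div_assoc]
    _ = ∫ x, f x * numeratorWm w x ∂(Chebyshev.measureT.prod Chebyshev.measureT) := by
      conv_rhs => rw [← hTT.map_eq]
      rw [integral_map hTT.aemeasurable (hTT.map_eq.symm ▸ hmeas)]
      rfl
    _ = _ := by
      simp only [integral_prod_measureT, numeratorWm, Wm, mul_div_assoc]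

end
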